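/- arXiv:2410.00784 — 2 statements merged into one kernel-verified Lean document; each statement's English description precedes it below -/
import Mathlib

section
/- Let ρ : ℤ^k → GL(d, ℝ) be a group homomorphism. Then there exist finitely many pairwise distinct additive maps χ₁, …, χ_r : ℤ^k → ℝ (group homomorphisms into (ℝ, +)) such that ℝ^d is the internal direct sum E^{χ₁} ⊕ ⋯ ⊕ E^{χ_r}, where E^χ = {v ≠ 0 : for every a ∈ ℤ^k, lim_{n→∞} (1/n)·log‖ρ(n·a)v‖ = χ(a)} ∪ {0}; moreover each subspace E^{χ_i} is invariant under ρ(a) for every a ∈ ℤ^k. -/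
open Filter

/-- The Lyapunov set of a linear `ℤᵏ`-action `ρ` and a function `χ : ℤᵏ → ℝ`: all nonzero
vectors `v` such that `(1/n)·log‖ρ(n·a)v‖ → χ(a)` for every `a ∈ ℤᵏ`, together with `0`. -/
def lyapunovSet {k d : ℕ} (ρ : (Fin k → ℤ) → Matrix (Fin d) (Fin d) ℝ)
    (χ : (Fin k → ℤ) → ℝ) : Set (EuclideanSpace ℝ (Fin d)) :=
  {v | v ≠ 0 ∧ ∀ a : Fin k → ℤ,
      Tendsto (fun n : ℕ => (1 / (n : ℝ)) *
        Real.log ‖Matrix.toEuclideanLin (ρ (n • a)) v‖) atTop (nhds (χ a))} ∪ {0}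

open Asymptotics

section Growth

variable {𝕜 E : Type*} [NontriviallyNormedField 𝕜] [NormedAddCommGroup E] [NormedSpace 𝕜 E]

/-- The vectors whose orbit under `f` grows at most like `r ^ n`. -/
def growthSubmodule (f : Module.End 𝕜 E) (r : ℝ) : Submodule 𝕜 E where
  carrier := {v | (fun n : ℕ => (f ^ n) v) =O[atTop] fun n => r ^ n}
  add_mem' hv hw := by simpa using IsBigO.add hv hw
  zero_mem' := by simpa using isBigO_zero _ _
  smul_mem' c v hv := by simpa [Pi.smul_def] using IsBigO.const_smul_left hv c

lemma mem_growthSubmodule {f : Module.End 𝕜 E} {r : ℝ} {v : E} :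
    v ∈ growthSubmodule f r ↔ (fun n : ℕ => (f ^ n) v) =O[atTop] fun n => r ^ n :=
  Iff.rfl

lemma mem_growthSubmodule_iff_exists {f : Module.End 𝕜 E} {r : ℝ} (hr : 0 < r) {v : E} :
    v ∈ growthSubmodule f r ↔ ∃ C, ∀ n : ℕ, ‖(f ^ n) v‖ ≤ C * r ^ n := by
  constructor
  · intro h
    obtain ⟨C, -, hC⟩ := bound_of_isBigO_nat_atTop (mem_growthSubmodule.1 h)
    refine ⟨C, fun n => ?_⟩
    simpa [abs_of_pos hr] using hC (x := n) (pow_pos hr n).ne'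
  · rintro ⟨C, hC⟩
    refine IsBigO.of_bound C (Eventually.of_forall fun n => ?_)
    simpa [abs_of_pos hr] using hC n

lemma map_mem_growthSubmodule [CompleteSpace 𝕜] [FiniteDimensional 𝕜 E] {f g : Module.End 𝕜 E}
    (hfg : Commute f g) {r : ℝ} {v : E} (hv : v ∈ growthSubmodule f r) :
    g v ∈ growthSubmodule f r := by
  have h := (LinearMap.toContinuousLinearMap g).isBigO_comp (fun n : ℕ => (f ^ n) v) atTop
  refine mem_growthSubmodule.2 (IsBigO.trans (IsBigO.congr_left h fun n => ?_) hv)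
  exact (LinearMap.congr_fun (hfg.pow_left n).eq v).symm

lemma growthSubmodule_of_sub_smul_mem {f : Module.End 𝕜 E} {c : 𝕜} {r : ℝ} (hr : ‖c‖ < r)
    {v : E} (hv : (f - c • 1) v ∈ growthSubmodule f r) : v ∈ growthSubmodule f r := by
  have hr0 : 0 < r := (norm_nonneg c).trans_lt hr
  obtain ⟨C, hC⟩ := (mem_growthSubmodule_iff_exists hr0).1 hv
  refine (mem_growthSubmodule_iff_exists hr0).2 ⟨max ‖v‖ (C / (r - ‖c‖)), fun n => ?_⟩
  set D := max ‖v‖ (C / (r - ‖c‖))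
  have hD : C ≤ D * (r - ‖c‖) := (div_le_iff₀ (sub_pos.2 hr)).1 (le_max_right _ _)
  induction n with
  | zero => simp [D]
  | succ n ih =>
    have hstep : (f ^ (n + 1)) v = c • (f ^ n) v + (f ^ n) ((f - c • 1) v) := by
      simp [pow_succ, map_sub]
    calc ‖(f ^ (n + 1)) v‖ ≤ ‖c‖ * ‖(f ^ n) v‖ + ‖(f ^ n) ((f - c • 1) v)‖ := by
          rw [hstep, ← norm_smul]; exact norm_add_le _ _
      _ ≤ ‖c‖ * (D * r ^ n) + D * (r - ‖c‖) * r ^ n := by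
          gcongr
          exact (hC n).trans (by gcongr)
      _ = D * r ^ (n + 1) := by ring

lemma maxGenEigenspace_le_growthSubmodule (f : Module.End 𝕜 E) {c : 𝕜} {r : ℝ} (hr : ‖c‖ < r) :
    f.maxGenEigenspace c ≤ growthSubmodule f r := by
  intro v hv
  obtain ⟨p, hp⟩ := Module.End.mem_maxGenEigenspace _ _ _ |>.1 hv
  clear hv
  induction p generalizing v with
  | zero => simp_all
  | succ p ih =>
    exact growthSubmodule_of_sub_smul_mem hr (ih (by rwa [pow_succ] at hp))

end Growth

section LowerBound

variable {E : Type*} [NormedAddCommGroup E] [NormedSpace ℝ E] [FiniteDimensional ℝ E]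

lemma exists_uniform_bound_growthSubmodule (f : Module.End ℝ E) {r : ℝ} (hr : 0 < r) :
    ∃ C, ∀ v ∈ growthSubmodule f r, ∀ n : ℕ, ‖(f ^ n) v‖ ≤ C * r ^ n * ‖v‖ := by
  have : CompleteSpace (growthSubmodule f r) := FiniteDimensional.complete ℝ _
  let g : ℕ → growthSubmodule f r →L[ℝ] E := fun n =>
    (r ^ n)⁻¹ • LinearMap.toContinuousLinearMap ((f ^ n).domRestrict (growthSubmodule f r))
  have hg (n : ℕ) (v : growthSubmodule f r) : ‖(f ^ n) v‖ = r ^ n * ‖g n v‖ := by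
    simp [g, norm_smul, abs_of_pos hr, hr.ne']
  obtain ⟨C, hC⟩ := banach_steinhaus (g := g) fun v => by
    obtain ⟨C, hC⟩ := (mem_growthSubmodule_iff_exists hr).1 v.2
    refine ⟨C, fun n => ?_⟩
    have h := hC n
    rw [hg, mul_comm] at h
    exact le_of_mul_le_mul_right h (pow_pos hr n)
  refine ⟨C, fun v hv n => ?_⟩
  calc ‖(f ^ n) v‖ = r ^ n * ‖g n ⟨v, hv⟩‖ := hg n ⟨v, hv⟩
    _ ≤ r ^ n * (C * ‖v‖) := by gcongr; exact (g n).le_of_opNorm_le (hC n) _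
    _ = C * r ^ n * ‖v‖ := by ring

lemma exists_lower_bound_of_mem_growthSubmodule {f g : Module.End ℝ E} (hgf : g * f = 1)
    {r : ℝ} (hr : 0 < r) {v : E} (hv : v ∈ growthSubmodule g r) :
    ∃ C > 0, ∀ n : ℕ, ‖v‖ ≤ C * r ^ n * ‖(f ^ n) v‖ := by
  have hcomm : Commute g f := hgf.trans (mul_eq_one_comm.1 hgf).symm
  obtain ⟨C, hC⟩ := exists_uniform_bound_growthSubmodule g hr
  refine ⟨max C 1, by positivity, fun n => ?_⟩
  have h1 : (g ^ n) ((f ^ n) v) = v := by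
    rw [← Module.End.mul_apply, ← hcomm.mul_pow, hgf, one_pow, Module.End.one_apply]
  calc ‖v‖ = ‖(g ^ n) ((f ^ n) v)‖ := by rw [h1]
    _ ≤ C * r ^ n * ‖(f ^ n) v‖ := hC _ (map_mem_growthSubmodule (hcomm.pow_right n) hv) n
    _ ≤ max C 1 * r ^ n * ‖(f ^ n) v‖ := by gcongr; exact le_max_left _ _

lemma disjoint_growthSubmodule {f g : Module.End ℝ E} (hgf : g * f = 1) {r s : ℝ} (hr : 0 < r)
    (hs : 0 < s) (hrs : r * s < 1) : Disjoint (growthSubmodule f r) (growthSubmodule g s) := by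
  rw [Submodule.disjoint_def]
  intro v hf hg
  obtain ⟨C, hC⟩ := (mem_growthSubmodule_iff_exists hr).1 hf
  obtain ⟨D, hD0, hD⟩ := exists_lower_bound_of_mem_growthSubmodule hgf hs hg
  have hlim : Tendsto (fun n : ℕ => D * C * (r * s) ^ n) atTop (nhds 0) := by
    simpa using (tendsto_pow_atTop_nhds_zero_of_lt_one (by positivity) hrs).const_mul (D * C)
  refine norm_le_zero_iff.1 (ge_of_tendsto' hlim fun n => ?_)
  calc ‖v‖ ≤ D * s ^ n * ‖(f ^ n) v‖ := hD n
    _ ≤ D * s ^ n * (C * r ^ n) := by gcongr; exact hC n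
    _ = D * C * (r * s) ^ n := by rw [mul_pow]; ring

end LowerBound

section Action

variable {A 𝕜 E : Type*} [AddCommGroup A] [Field 𝕜] [AddCommGroup E] [Module 𝕜 E]
  {T : A → Module.End 𝕜 E}

lemma action_nsmul (h0 : T 0 = 1) (hadd : ∀ a b, T (a + b) = T a * T b) (n : ℕ) (a : A) :
    T (n • a) = T a ^ n := by
  induction n with
  | zero => simp [h0]
  | succ n ih => rw [succ_nsmul, hadd, ih, pow_succ]

lemma action_neg_mul (h0 : T 0 = 1) (hadd : ∀ a b, T (a + b) = T a * T b) (a : A) :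
    T (-a) * T a = 1 := by
  rw [← hadd, neg_add_cancel, h0]

lemma action_commute (hadd : ∀ a b, T (a + b) = T a * T b) (a b : A) :
    Commute (T a) (T b) := by
  rw [Commute, SemiconjBy, ← hadd, ← hadd, add_comm]

lemma exists_mem_apply_eq_zero_of_pow {g : Module.End 𝕜 E} {W : Submodule 𝕜 E}
    (hW : ∀ v ∈ W, g v ∈ W) {u : E} (hu : u ∈ W) (hu0 : u ≠ 0) {p : ℕ} (hp : (g ^ p) u = 0) :
    ∃ w ∈ W, w ≠ 0 ∧ g w = 0 := by
  induction p generalizing u with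
  | zero => exact absurd hp hu0
  | succ p ih =>
    by_cases h : g u = 0
    · exact ⟨u, hu, hu0, h⟩
    · exact ih (hW u hu) h (by rwa [pow_succ] at hp)

lemma apply_eq_smul_of_apply_sub_eq_zero {f : Module.End 𝕜 E} {c : 𝕜} {w : E}
    (h : (f - c • 1) w = 0) : f w = c • w := by
  simpa [sub_eq_zero] using h

lemma eq_of_mem_maxGenEigenspace_of_apply_eq_smul {f : Module.End 𝕜 E} {c c' : 𝕜} {w : E}
    (hw : w ∈ f.maxGenEigenspace c) (hw0 : w ≠ 0) (h : f w = c' • w) : c' = c := by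
  by_contra hne
  refine hw0 (Submodule.disjoint_def.1 (f.disjoint_genEigenspace hne ⊤ ⊤) w ?_ hw)
  exact Module.End.genEigenspace_le_maximal _ _ 1
    ((Module.End.mem_genEigenspace_one).2 h)

/-- The eigenvalues attached to a nonzero joint generalized eigenspace are multiplicative. -/
lemma eigenvalue_add_of_iInf_maxGenEigenspace_ne_bot
    (hadd : ∀ a b, T (a + b) = T a * T b) {c : A → 𝕜}
    (hc : ⨅ a, (T a).maxGenEigenspace (c a) ≠ ⊥) (a b : A) : c (a + b) = c a * c b := by
  set W := ⨅ a, (T a).maxGenEigenspace (c a) with hWdef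
  have hmem {v : E} (hv : v ∈ W) (a : A) : v ∈ (T a).maxGenEigenspace (c a) :=
    (Submodule.mem_iInf _).1 hv a
  have hT (a : A) (v : E) (hv : v ∈ W) : (T a - c a • 1) v ∈ W := by
    refine (Submodule.mem_iInf _).2 fun b =>
      Module.End.mapsTo_maxGenEigenspace_of_comm ?_ (c b) (hmem hv b)
    exact (action_commute hadd b a).sub_right ((Commute.one_right _).smul_right _)
  obtain ⟨v, hv, hv0⟩ := Submodule.exists_mem_ne_zero_of_ne_bot hc
  obtain ⟨p, hp⟩ := (Module.End.mem_maxGenEigenspace _ _ _).1 (hmem hv a)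
  obtain ⟨u, hu, hu0, hua⟩ := exists_mem_apply_eq_zero_of_pow (hT a) hv hv0 hp
  obtain ⟨q, hq⟩ := (Module.End.mem_maxGenEigenspace _ _ _).1 (hmem hu b)
  have hinv : ∀ x ∈ W ⊓ LinearMap.ker (T a - c a • 1), (T b - c b • 1) x ∈
      W ⊓ LinearMap.ker (T a - c a • 1) := by
    rintro x ⟨hxW, hx⟩
    refine ⟨hT b x hxW, LinearMap.mem_ker.2 ?_⟩
    have hcomm : Commute (T a - c a • 1) (T b - c b • 1) :=
      ((action_commute hadd a b).sub_left ((Commute.one_left _).smul_left _)).sub_right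
        ((Commute.one_right _).smul_right _)
    rw [← Module.End.mul_apply, hcomm.eq, Module.End.mul_apply, LinearMap.mem_ker.1 hx, map_zero]
  obtain ⟨w, ⟨hwW, hwa⟩, hw0, hwb⟩ :=
    exists_mem_apply_eq_zero_of_pow hinv ⟨hu, LinearMap.mem_ker.2 hua⟩ hu0 hq
  refine (eq_of_mem_maxGenEigenspace_of_apply_eq_smul (hmem hwW (a + b)) hw0 ?_).symm
  rw [hadd, Module.End.mul_apply, apply_eq_smul_of_apply_sub_eq_zero hwb, map_smul,
    apply_eq_smul_of_apply_sub_eq_zero (LinearMap.mem_ker.1 hwa), smul_smul, mul_comm]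

lemma eigenvalue_zero_of_iInf_maxGenEigenspace_ne_bot (h0 : T 0 = 1) {c : A → 𝕜}
    (hc : ⨅ a, (T a).maxGenEigenspace (c a) ≠ ⊥) : c 0 = 1 := by
  obtain ⟨v, hv, hv0⟩ := Submodule.exists_mem_ne_zero_of_ne_bot hc
  refine (eq_of_mem_maxGenEigenspace_of_apply_eq_smul ((Submodule.mem_iInf _).1 hv 0) hv0 ?_).symm
  rw [h0, Module.End.one_apply, one_smul]

end Action

lemma exists_addMonoidHom_exp_eq_norm {A 𝕜 : Type*} [AddCommGroup A] [NormedField 𝕜] {c : A → 𝕜}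
    (h0 : c 0 = 1) (hadd : ∀ a b, c (a + b) = c a * c b) :
    ∃ χ : A →+ ℝ, ∀ a, Real.exp (χ a) = ‖c a‖ := by
  have hne (a : A) : ‖c a‖ ≠ 0 := by
    refine norm_ne_zero_iff.2 fun h => ?_
    have := hadd a (-a)
    simp [h0, h] at this
  refine ⟨AddMonoidHom.mk' (fun a => Real.log ‖c a‖) fun a b => ?_, fun a => ?_⟩
  · rw [hadd, norm_mul, Real.log_mul (hne a) (hne b)]
  · exact Real.exp_log ((norm_nonneg _).lt_of_ne' (hne a))

section Lyapunov

variable {A E : Type*} [NormedAddCommGroup E] [NormedSpace ℝ E]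

/-- The vectors whose orbit under each `T a` grows with exponent at most `χ a`. -/
noncomputable def lyapunovSubmodule (T : A → Module.End ℝ E) (χ : A → ℝ) : Submodule ℝ E :=
  ⨅ a, ⨅ r, ⨅ _ : Real.exp (χ a) < r, growthSubmodule (T a) r

lemma mem_lyapunovSubmodule {T : A → Module.End ℝ E} {χ : A → ℝ} {v : E} :
    v ∈ lyapunovSubmodule T χ ↔ ∀ a r, Real.exp (χ a) < r → v ∈ growthSubmodule (T a) r := by
  simp [lyapunovSubmodule, Submodule.mem_iInf]

variable [AddCommGroup A] {T : A → Module.End ℝ E}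

lemma map_mem_lyapunovSubmodule [FiniteDimensional ℝ E] (hadd : ∀ a b, T (a + b) = T a * T b)
    {χ : A → ℝ} (a : A) {v : E} (hv : v ∈ lyapunovSubmodule T χ) :
    T a v ∈ lyapunovSubmodule T χ :=
  mem_lyapunovSubmodule.2 fun b r hr =>
    map_mem_growthSubmodule (action_commute hadd b a) (mem_lyapunovSubmodule.1 hv b r hr)

lemma iSupIndep_lyapunovSubmodule [FiniteDimensional ℝ E] (h0 : T 0 = 1)
    (hadd : ∀ a b, T (a + b) = T a * T b) :
    iSupIndep fun χ : A →+ ℝ => lyapunovSubmodule T χ := by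
  classical
  rw [iSupIndep_iff_finsetSum_eq_zero_imp_eq_zero]
  intro S
  induction S using Finset.strongInduction with
  | H S ih =>
  intro v hv hsum χ₁ hχ₁
  by_cases hall : ∀ χ₂ ∈ S, χ₂ = χ₁
  · rwa [Finset.sum_eq_single_of_mem χ₁ hχ₁ fun χ₂ h h' => absurd (hall χ₂ h) h'] at hsum
  push Not at hall
  obtain ⟨χ₂, hχ₂, hne⟩ := hall
  obtain ⟨a, ha⟩ := DFunLike.ne_iff.1 hne
  obtain ⟨χ, hχ, χ', hχ', hlt⟩ : ∃ χ ∈ S, ∃ χ' ∈ S, χ' a < χ a := by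
    rcases lt_or_gt_of_ne ha with h | h
    exacts [⟨χ₁, hχ₁, χ₂, hχ₂, h⟩, ⟨χ₂, hχ₂, χ₁, hχ₁, h⟩]
  set S₁ := S.filter fun ψ => ψ a < χ a with hS₁
  set S₂ := S.filter fun ψ => ¬ ψ a < χ a with hS₂
  have hsplit : ∑ ψ ∈ S₁, v ψ + ∑ ψ ∈ S₂, v ψ = 0 := by
    rw [Finset.sum_filter_add_sum_filter_not, hsum]
  obtain ⟨ψ₀, hψ₀, hmax⟩ := S₁.exists_max_image (fun ψ => ψ a)
    ⟨χ', Finset.mem_filter.2 ⟨hχ', hlt⟩⟩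
  obtain ⟨s, hs₁, hs₂⟩ := exists_between (Finset.mem_filter.1 hψ₀).2
  obtain ⟨t, ht₁, ht₂⟩ := exists_between hs₂
  have hmem₁ : ∑ ψ ∈ S₁, v ψ ∈ growthSubmodule (T a) (Real.exp s) := by
    refine Submodule.sum_mem _ fun ψ hψ => ?_
    refine mem_lyapunovSubmodule.1 (hv ψ (Finset.mem_filter.1 hψ).1) a _ ?_
    exact Real.exp_lt_exp.2 ((hmax ψ hψ).trans_lt hs₁)
  have hmem₂ : ∑ ψ ∈ S₂, v ψ ∈ growthSubmodule (T (-a)) (Real.exp (-t)) := by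
    refine Submodule.sum_mem _ fun ψ hψ => ?_
    refine mem_lyapunovSubmodule.1 (hv ψ (Finset.mem_filter.1 hψ).1) (-a) _ ?_
    rw [Real.exp_lt_exp, map_neg, neg_lt_neg_iff]
    exact ht₂.trans_le (not_lt.1 (Finset.mem_filter.1 hψ).2)
  have hzero₁ : ∑ ψ ∈ S₁, v ψ = 0 := by
    refine Submodule.disjoint_def.1 (disjoint_growthSubmodule (action_neg_mul h0 hadd a)
      (Real.exp_pos s) (Real.exp_pos (-t)) ?_) _ hmem₁ ?_
    · rw [← Real.exp_add, Real.exp_lt_one_iff]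
      linarith
    · rw [eq_neg_of_add_eq_zero_left hsplit]
      exact Submodule.neg_mem _ hmem₂
  have hzero₂ : ∑ ψ ∈ S₂, v ψ = 0 := by rwa [hzero₁, zero_add] at hsplit
  by_cases h : χ₁ a < χ a
  · refine ih S₁ (Finset.filter_ssubset.2 ⟨χ, hχ, lt_irrefl _⟩) v
      (fun ψ hψ => hv ψ (Finset.mem_filter.1 hψ).1) hzero₁ χ₁ (Finset.mem_filter.2 ⟨hχ₁, h⟩)
  · refine ih S₂ (Finset.filter_ssubset.2 ⟨χ', hχ', not_not.2 hlt⟩) v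
      (fun ψ hψ => hv ψ (Finset.mem_filter.1 hψ).1) hzero₂ χ₁ (Finset.mem_filter.2 ⟨hχ₁, h⟩)

/-- If the action `T` is a quotient of a complex linear action, then its Lyapunov subspaces span. -/
lemma iSup_lyapunovSubmodule_eq_top {F : Type*} [NormedAddCommGroup F] [NormedSpace ℂ F]
    [FiniteDimensional ℂ F] {Tc : A → Module.End ℂ F} (h0 : Tc 0 = 1)
    (hadd : ∀ a b, Tc (a + b) = Tc a * Tc b) (L : F →L[ℝ] E) (hL : Function.Surjective L)
    (hLT : ∀ a w, L (Tc a w) = T a (L w)) :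
    ⨆ χ : A →+ ℝ, lyapunovSubmodule T χ = ⊤ := by
  have htop :=
    Module.End.iSup_iInf_maxGenEigenspace_eq_top_of_iSup_maxGenEigenspace_eq_top_of_commute
    Tc (fun a b _ => action_commute hadd a b) fun a => Module.End.iSup_maxGenEigenspace_eq_top _
  rw [Submodule.eq_top_iff']
  intro x
  obtain ⟨w, rfl⟩ := hL x
  have hw : w ∈ ⨆ c : A → ℂ, ⨅ a, (Tc a).maxGenEigenspace (c a) := htop ▸ Submodule.mem_top
  induction hw using Submodule.iSup_induction' with
  | zero => simp
  | add y z _ _ hy hz => rw [map_add]; exact Submodule.add_mem _ hy hz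
  | mem c w hw =>
    by_cases hc : ⨅ a, (Tc a).maxGenEigenspace (c a) = ⊥
    · rw [hc, Submodule.mem_bot] at hw
      simp [hw]
    obtain ⟨χ, hχ⟩ := exists_addMonoidHom_exp_eq_norm
      (eigenvalue_zero_of_iInf_maxGenEigenspace_ne_bot h0 hc)
      (eigenvalue_add_of_iInf_maxGenEigenspace_ne_bot hadd hc)
    refine Submodule.mem_iSup_of_mem χ (mem_lyapunovSubmodule.2 fun a r hr => ?_)
    have hgrowth := maxGenEigenspace_le_growthSubmodule (Tc a) (hχ a ▸ hr)
      ((Submodule.mem_iInf _).1 hw a)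
    refine mem_growthSubmodule.2 (IsBigO.trans (IsBigO.congr_left
      (L.isBigO_comp (fun n : ℕ => (Tc a ^ n) w) atTop) fun n => ?_) hgrowth)
    induction n with
    | zero => simp
    | succ n ih => rw [pow_succ', pow_succ', Module.End.mul_apply, hLT, ih, Module.End.mul_apply]

lemma tendsto_log_norm_of_mem_growthSubmodule [FiniteDimensional ℝ E] {f g : Module.End ℝ E}
    (hgf : g * f = 1) {s : ℝ} {v : E} (hv0 : v ≠ 0)
    (hf : ∀ r, Real.exp s < r → v ∈ growthSubmodule f r)
    (hg : ∀ r, Real.exp (-s) < r → v ∈ growthSubmodule g r) :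
    Tendsto (fun n : ℕ => 1 / (n : ℝ) * Real.log ‖(f ^ n) v‖) atTop (nhds s) := by
  have hpos : 0 < ‖v‖ := norm_pos_iff.2 hv0
  have hcomm : Commute g f := hgf.trans (mul_eq_one_comm.1 hgf).symm
  have hfn (n : ℕ) : 0 < ‖(f ^ n) v‖ := by
    refine norm_pos_iff.2 fun h => hv0 ?_
    have h1 : (g ^ n) ((f ^ n) v) = v := by
      rw [← Module.End.mul_apply, ← hcomm.mul_pow, hgf, one_pow, Module.End.one_apply]
    rw [← h1, h, map_zero]
  have hlim (K t : ℝ) : Tendsto (fun n : ℕ => K / (n : ℝ) + t) atTop (nhds t) := by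
    simpa using (tendsto_const_div_atTop_nhds_zero_nat K).add_const t
  rw [tendsto_order]
  constructor
  · intro u hu
    obtain ⟨t, hut, hts⟩ := exists_between hu
    obtain ⟨C, hC0, hC⟩ := exists_lower_bound_of_mem_growthSubmodule hgf (Real.exp_pos (-t))
      (hg _ (Real.exp_lt_exp.2 (neg_lt_neg hts)))
    filter_upwards [(hlim (Real.log ‖v‖ - Real.log C) t).eventually_const_lt hut,
      eventually_gt_atTop 0] with n hn hn0
    refine hn.trans_le ?_
    have hn0' : (0 : ℝ) < n := Nat.cast_pos.2 hn0
    have h := Real.log_le_log hpos (hC n)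
    rw [Real.log_mul (by positivity) (hfn n).ne', Real.log_mul hC0.ne' (by positivity),
      Real.log_pow, Real.log_exp] at h
    rw [one_div_mul_eq_div, div_add' _ _ _ hn0'.ne', div_le_div_iff_of_pos_right hn0']
    linarith
  · intro u hu
    obtain ⟨t, hst, htu⟩ := exists_between hu
    obtain ⟨C, hC⟩ := (mem_growthSubmodule_iff_exists (Real.exp_pos t)).1
      (hf _ (Real.exp_lt_exp.2 hst))
    have hC0 : 0 < C := hpos.trans_le (by simpa using hC 0)
    filter_upwards [(hlim (Real.log C) t).eventually_lt_const htu,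
      eventually_gt_atTop 0] with n hn hn0
    refine lt_of_le_of_lt ?_ hn
    have hn0' : (0 : ℝ) < n := Nat.cast_pos.2 hn0
    have h := Real.log_le_log (hfn n) (hC n)
    rw [Real.log_mul hC0.ne' (by positivity), Real.log_pow, Real.log_exp] at h
    rw [one_div_mul_eq_div, div_add' _ _ _ hn0'.ne', div_le_div_iff_of_pos_right hn0']
    linarith

lemma mem_growthSubmodule_of_tendsto_log_norm {f : Module.End ℝ E} {s r : ℝ} {v : E}
    (h : Tendsto (fun n : ℕ => 1 / (n : ℝ) * Real.log ‖(f ^ n) v‖) atTop (nhds s))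
    (hr : Real.exp s < r) : v ∈ growthSubmodule f r := by
  have hr0 : 0 < r := (Real.exp_pos s).trans hr
  refine mem_growthSubmodule.2 (IsBigO.of_bound 1 ?_)
  filter_upwards [h.eventually_lt_const ((Real.lt_log_iff_exp_lt hr0).2 hr),
    eventually_gt_atTop 0] with n hn hn0
  rw [one_mul, Real.norm_of_nonneg (by positivity)]
  rcases (norm_nonneg ((f ^ n) v)).eq_or_lt with h0 | hpos
  · rw [← h0]; positivity
  · rw [← Real.log_le_log_iff hpos (by positivity), Real.log_pow]
    rw [one_div_mul_eq_div, div_lt_iff₀ (Nat.cast_pos.2 hn0)] at hn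
    linarith

end Lyapunov

lemma coe_lyapunovSubmodule_eq_lyapunovSet {k d : ℕ}
    {ρ : (Fin k → ℤ) → Matrix (Fin d) (Fin d) ℝ} {T : (Fin k → ℤ) → Module.End ℝ _}
    (hT : ∀ a, T a = Matrix.toEuclideanLin (ρ a)) (h0 : T 0 = 1)
    (hadd : ∀ a b, T (a + b) = T a * T b) (χ : (Fin k → ℤ) →+ ℝ) :
    (lyapunovSubmodule T χ : Set (EuclideanSpace ℝ (Fin d))) = lyapunovSet ρ χ := by
  ext v
  simp only [lyapunovSet, ← hT, action_nsmul h0 hadd, SetLike.mem_coe, Set.mem_union,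
    Set.mem_ofPred_eq, Set.mem_singleton_iff]
  constructor
  · intro hv
    refine or_iff_not_imp_right.2 fun hv0 => ⟨hv0, fun a => ?_⟩
    refine tendsto_log_norm_of_mem_growthSubmodule (action_neg_mul h0 hadd a) hv0
      (mem_lyapunovSubmodule.1 hv a) ?_
    simpa using mem_lyapunovSubmodule.1 hv (-a)
  · rintro (⟨-, h⟩ | rfl)
    · exact mem_lyapunovSubmodule.2 fun a r hr => mem_growthSubmodule_of_tendsto_log_norm (h a) hr
    · exact Submodule.zero_mem _

/-- The coordinatewise real part. -/
def euclideanRe (d : ℕ) : EuclideanSpace ℂ (Fin d) →ₗ[ℝ] EuclideanSpace ℝ (Fin d) where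
  toFun w := WithLp.toLp 2 fun i => (w i).re
  map_add' v w := by ext; simp
  map_smul' c w := by ext; simp

lemma euclideanRe_surjective (d : ℕ) : Function.Surjective (euclideanRe d) := fun v =>
  ⟨WithLp.toLp 2 fun i => (v i : ℂ), by ext; simp [euclideanRe]⟩

lemma euclideanRe_toEuclideanLin_map {d : ℕ} (M : Matrix (Fin d) (Fin d) ℝ)
    (w : EuclideanSpace ℂ (Fin d)) :
    euclideanRe d (Matrix.toEuclideanLin (M.map Complex.ofRealHom) w) =
      Matrix.toEuclideanLin M (euclideanRe d w) := by
  ext i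
  simp [euclideanRe, Matrix.toLpLin_apply, Matrix.mulVec, dotProduct]

lemma exists_fin_isInternal_of_iSupIndep {ι R M : Type*} [Ring R] [AddCommGroup M] [Module R M]
    [IsNoetherian R M] {p : ι → Submodule R M} (hp : iSupIndep p) (htop : ⨆ i, p i = ⊤) :
    ∃ (r : ℕ) (e : Fin r → ι), Function.Injective e ∧ DirectSum.IsInternal fun j => p (e j) := by
  have hfin : Finite {i // p i ≠ ⊥} := (WellFoundedGT.finite_ne_bot_of_iSupIndep hp).to_subtype
  obtain ⟨r, ⟨e⟩⟩ := Finite.exists_equiv_fin {i // p i ≠ ⊥}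
  have hinj : Function.Injective fun j => (e.symm j).1 :=
    Subtype.val_injective.comp e.symm.injective
  refine ⟨r, fun j => (e.symm j).1, hinj,
    DirectSum.isInternal_submodule_of_iSupIndep_of_iSup_eq_top (hp.comp hinj) ?_⟩
  rw [← htop, ← iSup_ne_bot_subtype p]
  exact e.symm.iSup_comp (g := fun i => p i.1)

/-- For a group homomorphism `ρ : ℤᵏ → GL(d, ℝ)` there are finitely many pairwise distinct
additive maps `χ₁, …, χ_r : ℤᵏ → ℝ` such that `ℝᵈ` is the internal direct sum of the Lyapunov
subspaces `E^{χ_i}`, each of which is invariant under every `ρ(a)`. -/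
theorem lyapunov_decomposition {k d : ℕ}
    (ρ : (Fin k → ℤ) → Matrix (Fin d) (Fin d) ℝ)
    (hρ0 : ρ 0 = 1) (hρadd : ∀ a b : Fin k → ℤ, ρ (a + b) = ρ a * ρ b) :
    ∃ (r : ℕ) (χ : Fin r → ((Fin k → ℤ) →+ ℝ))
      (E : Fin r → Submodule ℝ (EuclideanSpace ℝ (Fin d))),
      Function.Injective χ ∧
      (∀ i : Fin r, (E i : Set (EuclideanSpace ℝ (Fin d))) = lyapunovSet ρ (χ i)) ∧
      DirectSum.IsInternal E ∧
      (∀ (i : Fin r) (a : Fin k → ℤ), ∀ v ∈ E i, Matrix.toEuclideanLin (ρ a) v ∈ E i) := by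
  let T : (Fin k → ℤ) → Module.End ℝ (EuclideanSpace ℝ (Fin d)) :=
    fun a => Matrix.toEuclideanLin (ρ a)
  have hT0 : T 0 = 1 := by simp only [T, hρ0, Matrix.toLpLin_one]; rfl
  have hTadd (a b) : T (a + b) = T a * T b := by
    simp only [T, hρadd, Matrix.toLpLin_mul_same]; rfl
  let Tc : (Fin k → ℤ) → Module.End ℂ (EuclideanSpace ℂ (Fin d)) :=
    fun a => Matrix.toEuclideanLin ((ρ a).map Complex.ofRealHom)
  have hTc0 : Tc 0 = 1 := by
    simp only [Tc, hρ0, Matrix.map_one _ (map_zero _) (map_one _), Matrix.toLpLin_one]; rfl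
  have hTcadd (a b) : Tc (a + b) = Tc a * Tc b := by
    simp only [Tc, hρadd, Matrix.map_mul, Matrix.toLpLin_mul_same]; rfl
  have hindep := iSupIndep_lyapunovSubmodule hT0 hTadd
  have htop : ⨆ χ : (Fin k → ℤ) →+ ℝ, lyapunovSubmodule T χ = ⊤ :=
    iSup_lyapunovSubmodule_eq_top hTc0 hTcadd (euclideanRe d).toContinuousLinearMap
      (euclideanRe_surjective d) fun a w => euclideanRe_toEuclideanLin_map (ρ a) w
  obtain ⟨r, χ, hinj, hint⟩ := exists_fin_isInternal_of_iSupIndep hindep htop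
  exact ⟨r, χ, fun i => lyapunovSubmodule T (χ i), hinj,
    fun i => coe_lyapunovSubmodule_eq_lyapunovSet (fun _ => rfl) hT0 hTadd (χ i), hint,
    fun i a v hv => map_mem_lyapunovSubmodule hTadd a hv⟩
end

section
/- Let ν be a Borel probability measure on the circle ℝ/ℤ that is equivalent to the Haar measure (ν and Haar have the same null sets). Then for every s ∈ ℝ/ℤ there exists a unique orientation-preserving homeomorphism h of ℝ/ℤ such that h preserves ν and the rotation number of h equals s. -/
open MeasureTheory Filter

theorem UnitAddCircle.coe_eq_coe_iff_exists_int {x y : ℝ} :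
    (x : UnitAddCircle) = y ↔ ∃ n : ℤ, x = y + n := by
  rw [← sub_eq_zero, ← AddCircle.coe_sub, AddCircle.coe_eq_zero_iff]
  simp only [zsmul_eq_mul, mul_one, eq_sub_iff_add_eq', eq_comm (a := x)]

theorem UnitAddCircle.preimage_image_Ioo_inter_Ioc {a b : ℝ} (hb : b ≤ a + 1) :
    ((↑) : ℝ → UnitAddCircle) ⁻¹' (((↑) : ℝ → UnitAddCircle) '' Set.Ioo a b) ∩
      Set.Ioc a (a + 1) = Set.Ioo a b := by
  ext x
  refine ⟨?_, fun hx => ⟨⟨x, hx, rfl⟩, hx.1, hx.2.le.trans hb⟩⟩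
  rintro ⟨⟨y, hy, hyx⟩, hx⟩
  obtain ⟨n, rfl⟩ := coe_eq_coe_iff_exists_int.1 hyx
  have h1 : (n : ℝ) < 1 := by linarith [hx.1, hy.2]
  have h2 : (-1 : ℝ) < n := by linarith [hx.2, hy.1]
  have h3 : n = 0 := by
    have : n < 1 := by exact_mod_cast h1
    have : -1 < n := by exact_mod_cast h2
    omega
  simpa [h3] using hy

/-- A probability measure on the circle equivalent to Haar measure lifts to a measure `m` on `ℝ`
whose distribution function `G` is a strictly increasing continuous map of degree one. -/
theorem UnitAddCircle.exists_measure_lift_distribution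
    (ν : Measure UnitAddCircle) [IsProbabilityMeasure ν]
    (hν₁ : ν ≪ (volume : Measure UnitAddCircle))
    (hν₂ : (volume : Measure UnitAddCircle) ≪ ν) :
    ∃ (m : Measure ℝ) (G : ℝ → ℝ),
      (∀ a, MeasurePreserving ((↑) : ℝ → UnitAddCircle) (m.restrict (Set.Ioc a (a + 1))) ν) ∧
      (∀ a b, a ≤ b → m (Set.Ioc a b) = ENNReal.ofReal (G b - G a)) ∧
      (∀ a b, m (Set.Ioo a b) = m (Set.Ioc a b)) ∧
      StrictMono G ∧ Continuous G ∧ ∀ x, G (x + 1) = G x + 1 := by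
  have hpos : ν.IsOpenPosMeasure := hν₂.isOpenPosMeasure
  set ρ : UnitAddCircle → ℝ := fun x => (ν.rnDeriv volume x).toReal with hρ
  have hρm : Measurable ρ := (Measure.measurable_rnDeriv ν volume).ennreal_toReal
  have hρν : volume.withDensity (fun x => ENNReal.ofReal (ρ x)) = ν := by
    rw [← Measure.withDensity_rnDeriv_eq ν volume hν₁]
    apply withDensity_congr_ae
    filter_upwards [Measure.rnDeriv_lt_top ν volume] with x hx
    exact ENNReal.ofReal_toReal hx.ne
  have hρi : Integrable ρ volume := Measure.integrable_toReal_rnDeriv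
  have hmk : Measurable ((↑) : ℝ → UnitAddCircle) := AddCircle.measurable_mk'
  have hii : ∀ a b : ℝ, IntervalIntegrable (fun x : ℝ => ρ x) volume a b := by
    have h01 : IntervalIntegrable (fun x : ℝ => ρ x) volume 0 1 := by
      rw [intervalIntegrable_iff_integrableOn_Ioc_of_le zero_le_one]
      have := (UnitAddCircle.measurePreserving_mk 0).integrable_comp (g := ρ)
        hρi.aestronglyMeasurable
      rw [zero_add] at this
      exact this.2 hρi
    have hper : Function.Periodic (fun x : ℝ => ρ x) 1 := fun x => by simp
    exact hper.intervalIntegrable₀ one_ne_zero h01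
  set m : Measure ℝ := volume.withDensity (fun x : ℝ => ENNReal.ofReal (ρ x)) with hm
  have hmp : ∀ a, MeasurePreserving ((↑) : ℝ → UnitAddCircle)
      (m.restrict (Set.Ioc a (a + 1))) ν := by
    intro a
    refine ⟨hmk, ?_⟩
    ext s hs
    rw [Measure.map_apply hmk hs, hm, restrict_withDensity measurableSet_Ioc,
      withDensity_apply _ (hmk hs), ← hρν, withDensity_apply _ hs]
    exact (UnitAddCircle.measurePreserving_mk a).setLIntegral_comp_preimage hs
      hρm.ennreal_ofReal
  have hIoc : ∀ a b, a ≤ b → m (Set.Ioc a b) = ENNReal.ofReal (∫ x in a..b, ρ x) := by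
    intro a b hab
    rw [hm, withDensity_apply _ measurableSet_Ioc, intervalIntegral.integral_of_le hab,
      ofReal_integral_eq_lintegral_ofReal ((hii a b).1)
        (Eventually.of_forall fun x => ENNReal.toReal_nonneg)]
  have hIoo : ∀ a b, m (Set.Ioo a b) = m (Set.Ioc a b) := by
    intro a b
    exact measure_congr ((withDensity_absolutelyContinuous _ _).ae_le Ioo_ae_eq_Ioc)
  have hsub : ∀ a b : ℝ, (∫ x in (0 : ℝ)..b, ρ x) - ∫ x in (0 : ℝ)..a, ρ x = ∫ x in a..b, ρ x :=
    fun a b => intervalIntegral.integral_interval_sub_left (hii _ _) (hii _ _)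
  have hone : ∀ a : ℝ, ∫ x in a..a + 1, ρ x = 1 := by
    intro a
    have h1 := (hmp a).measure_preimage MeasurableSet.univ.nullMeasurableSet
    rw [Set.preimage_univ, Measure.restrict_apply_univ, measure_univ, hIoc _ _ (by linarith)] at h1
    simpa using h1
  refine ⟨m, fun b => ∫ x in (0 : ℝ)..b, ρ x, hmp, ?_, hIoo, ?_,
    intervalIntegral.continuous_primitive hii 0, ?_⟩
  · intro a b hab
    rw [hIoc a b hab, hsub]
  · intro a b hab
    rw [← sub_pos, hsub, ← ENNReal.ofReal_pos, ← hIoc a b hab.le, ← hIoo]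
    by_contra! h0
    have hab' : a < min b (a + 1) := lt_min hab (by linarith)
    have hopen : IsOpen (((↑) : ℝ → UnitAddCircle) '' Set.Ioo a (min b (a + 1))) :=
      QuotientAddGroup.isOpenMap_coe _ isOpen_Ioo
    refine (hopen.measure_pos ν ((Set.nonempty_Ioo.2 hab').image _)).ne' ?_
    rw [← (hmp a).measure_preimage hopen.measurableSet.nullMeasurableSet,
      Measure.restrict_apply (hmk hopen.measurableSet)]
    refine measure_mono_null ?_ (le_antisymm h0 zero_le)
    rw [UnitAddCircle.preimage_image_Ioo_inter_Ioc (min_le_right _ _)]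
    exact Set.Ioo_subset_Ioo_right (min_le_left _ _)
  · intro x
    have := hsub x (x + 1)
    rw [hone] at this
    dsimp only
    linarith

/-- For a Borel probability measure `ν` on the circle `ℝ/ℤ` equivalent to the Haar measure,
and any `s ∈ ℝ/ℤ`, there is a unique orientation-preserving homeomorphism of the circle
(induced by a strictly increasing continuous bijective lift `F` with `F(x+1) = F(x)+1`)
that preserves `ν` and has rotation number `s`. -/
theorem exists_unique_measure_preserving_homeo_of_rotation_number
    (ν : Measure UnitAddCircle) [IsProbabilityMeasure ν]
    (hν₁ : ν ≪ (volume : Measure UnitAddCircle))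
    (hν₂ : (volume : Measure UnitAddCircle) ≪ ν) :
    ∀ s : UnitAddCircle, ∃! h : UnitAddCircle → UnitAddCircle,
      MeasurePreserving h ν ν ∧
      ∃ F : ℝ → ℝ, StrictMono F ∧ Continuous F ∧ Function.Bijective F ∧
        (∀ x : ℝ, F (x + 1) = F x + 1) ∧
        (∀ x : ℝ, h ↑x = ↑(F x)) ∧
        ∃ t : ℝ, (↑t : UnitAddCircle) = s ∧
          Tendsto (fun n : ℕ => F^[n] 0 / (n : ℝ)) atTop (nhds t) := by
  obtain ⟨m, G, hmp, hIoc, hIoo, hGm, hGc, hG1⟩ :=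
    UnitAddCircle.exists_measure_lift_distribution ν hν₁ hν₂
  let Glift : CircleDeg1Lift := ⟨⟨G, hGm.monotone⟩, hG1⟩
  have hGs : Function.Surjective G := (Glift.continuous_iff_surjective).1 hGc
  let e : ℝ ≃o ℝ := hGm.orderIsoOfSurjective G hGs
  have he : ∀ x, e x = G x := fun _ => rfl
  have hτ : ∀ (F : CircleDeg1Lift) (c : ℝ), (∀ x, G (F x) = c + G x) → F.translationNumber = c := by
    intro F c h
    rw [← CircleDeg1Lift.translationNumber_translate c]
    exact CircleDeg1Lift.translationNumber_eq_of_semiconj (f := Glift) fun x => by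
      rw [CircleDeg1Lift.translate_apply]
      exact h x
  intro s
  obtain ⟨t, rfl⟩ := QuotientAddGroup.mk_surjective s
  let E : ℝ ≃o ℝ := (e.trans (OrderIso.addLeft t)).trans e.symm
  have hE : ∀ x, G (E x) = t + G x := fun x => e.apply_symm_apply _
  have hE1 : ∀ x, E (x + 1) = E x + 1 := fun x => by
    apply hGm.injective
    rw [hE, hG1, hG1, hE, add_assoc]
  let Elift : CircleDeg1Lift := ⟨⟨E, E.monotone⟩, hE1⟩
  have hper : Function.Periodic (fun x : ℝ => ((E x : ℝ) : UnitAddCircle)) 1 := fun x => by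
    simp only [hE1, AddCircle.coe_add, AddCircle.coe_period, add_zero]
  have hmk : Measurable ((↑) : ℝ → UnitAddCircle) := AddCircle.measurable_mk'
  have hEm : MeasurePreserving E m m := by
    refine ⟨E.continuous.measurable, ?_⟩
    symm
    have : IsLocallyFiniteMeasure m := by
      refine ⟨fun x => ⟨Set.Ioc (x - 1) (x + 1), Ioc_mem_nhds (by linarith) (by linarith), ?_⟩⟩
      rw [hIoc _ _ (by linarith)]
      exact ENNReal.ofReal_lt_top
    apply Measure.ext_of_Ioc
    intro a b hab
    obtain ⟨a, rfl⟩ := E.surjective a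
    obtain ⟨b, rfl⟩ := E.surjective b
    have hab' : a ≤ b := (E.lt_iff_lt.1 hab).le
    rw [Measure.map_apply E.continuous.measurable measurableSet_Ioc, hIoc _ _ hab.le]
    have : E ⁻¹' Set.Ioc (E a) (E b) = Set.Ioc a b := by ext; simp
    rw [this, hIoc _ _ hab', hE, hE, add_sub_add_left_eq_sub]
  have hcomp : ∀ x : ℝ, hper.lift (x : UnitAddCircle) = ((E x : ℝ) : UnitAddCircle) :=
    fun _ => rfl
  refine ⟨hper.lift, ⟨?_, E, E.strictMono, E.continuous, E.bijective, hE1, hcomp, t, rfl, ?_⟩, ?_⟩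
  · have hlift : Measurable hper.lift := by
      have : Continuous hper.lift :=
        continuous_quot_lift _ ((AddCircle.continuous_mk' 1).comp E.continuous)
      exact this.measurable
    have h1 := (hEm.restrict_preimage (s := Set.Ioc (E 0) (E 0 + 1)) measurableSet_Ioc)
    have : E ⁻¹' Set.Ioc (E 0) (E 0 + 1) = Set.Ioc 0 (0 + 1) := by
      rw [← hE1]; ext; simp
    rw [this] at h1
    have h2 := (hmp (E 0)).comp h1
    refine ⟨hlift, ?_⟩
    conv_lhs => rw [← (hmp 0).map_eq, Measure.map_map hlift hmk]
    exact h2.map_eq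
  · rw [← hτ Elift t hE]
    have hlim := Elift.tendsto_translation_number₀
    simp only [CircleDeg1Lift.coe_pow] at hlim
    exact hlim
  · rintro h ⟨hh, F, hFm, hFc, hFb, hF1, hhF, t', ht', hlim⟩
    let Flift : CircleDeg1Lift := ⟨⟨F, hFm.monotone⟩, hF1⟩
    have hFz : ∀ (x : ℝ) (n : ℤ), F (x + n) = F x + n := Flift.map_add_int
    have hinc : ∀ a b, a ≤ b → b ≤ a + 1 → G (F b) - G (F a) = G b - G a := by
      intro a b hab hb
      have hFab : F a ≤ F b := hFm.monotone hab
      have hvol : ∀ c d : ℝ, c ≤ d → d ≤ c + 1 →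
          ν (((↑) : ℝ → UnitAddCircle) '' Set.Ioo c d) = ENNReal.ofReal (G d - G c) := by
        intro c d hcd hd
        have hopen : IsOpen (((↑) : ℝ → UnitAddCircle) '' Set.Ioo c d) :=
          QuotientAddGroup.isOpenMap_coe _ isOpen_Ioo
        rw [← (hmp c).measure_preimage hopen.measurableSet.nullMeasurableSet,
          Measure.restrict_apply (hmk hopen.measurableSet),
          UnitAddCircle.preimage_image_Ioo_inter_Ioc hd, hIoo, hIoc _ _ hcd]
      have hopen : IsOpen (((↑) : ℝ → UnitAddCircle) '' Set.Ioo (F a) (F b)) :=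
        QuotientAddGroup.isOpenMap_coe _ isOpen_Ioo
      have hpre : h ⁻¹' (((↑) : ℝ → UnitAddCircle) '' Set.Ioo (F a) (F b)) =
          ((↑) : ℝ → UnitAddCircle) '' Set.Ioo a b := by
        ext z
        obtain ⟨x, rfl⟩ := QuotientAddGroup.mk_surjective z
        constructor
        · rintro ⟨y, hy, hyx⟩
          obtain ⟨n, rfl⟩ := UnitAddCircle.coe_eq_coe_iff_exists_int.1 (hyx.trans (hhF x))
          rw [← hFz, Set.mem_Ioo, hFm.lt_iff_lt, hFm.lt_iff_lt] at hy
          exact ⟨x + n, hy, UnitAddCircle.coe_eq_coe_iff_exists_int.2 ⟨n, rfl⟩⟩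
        · rintro ⟨y, hy, hyx⟩
          rw [Set.mem_preimage, ← hyx]
          exact ⟨F y, ⟨hFm hy.1, hFm hy.2⟩, (hhF y).symm⟩
      have key := hh.measure_preimage hopen.measurableSet.nullMeasurableSet
      rw [hpre, hvol a b hab hb,
        hvol _ _ hFab (by rw [← hF1]; exact hFm.monotone hb),
        ENNReal.ofReal_eq_ofReal_iff (sub_nonneg.2 (hGm.monotone hab))
          (sub_nonneg.2 (hGm.monotone hFab))] at key
      exact key.symm
    have hGz : ∀ (x : ℝ) (n : ℤ), G (x + n) = G x + n := Glift.map_add_int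
    have hconst : ∀ x, G (F x) = (G (F 0) - G 0) + G x := by
      intro x
      have h1 := hinc 0 (Int.fract x) (Int.fract_nonneg x) (by linarith [Int.fract_lt_one x])
      have h2 := hFz (Int.fract x) ⌊x⌋
      have h3 := hGz (Int.fract x) ⌊x⌋
      have h4 := hGz (F (Int.fract x)) ⌊x⌋
      rw [← h2] at h4
      rw [Int.fract_add_floor] at h3 h4
      linarith
    have hc := hτ Flift _ hconst
    rw [Flift.translationNumber_eq_of_tendsto₀ hlim] at hc
    obtain ⟨n, hn⟩ := UnitAddCircle.coe_eq_coe_iff_exists_int.1 ht'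
    funext z
    obtain ⟨x, rfl⟩ := QuotientAddGroup.mk_surjective z
    refine (hhF x).trans (UnitAddCircle.coe_eq_coe_iff_exists_int.2 ⟨n, ?_⟩)
    apply hGm.injective
    rw [hGz, hE, hconst, ← hc, hn]
    ring
end
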